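/- arXiv:1703.08879 — 6 statements merged into one kernel-verified Lean document; each statement's English description precedes it below -/
import Mathlib

section
/- Let X be a Polish space. If A ⊆ X is meager, then A is residually null, i.e., the annihilator 𝓝(A) = {μ ∈ 𝓜(X) : μ*(A) = 0} is comeager in 𝓜(X). -/
open MeasureTheory Set Topology
open scoped ENNReal symmDiff

/-- The annihilator of a set `A`: the set of Borel probability measures `μ` on `X`
whose induced outer measure vanishes on `A`. -/
def Annihilator {X : Type*} [MeasurableSpace X] (A : Set X) :
    Set (ProbabilityMeasure X) :=
  {μ : ProbabilityMeasure X | μ.toMeasure A = 0}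

/-- `A` is residually null if its annihilator is comeager in the space `𝓜(X)` of
Borel probability measures with the topology of weak convergence. -/
def ResiduallyNull {X : Type*} [TopologicalSpace X] [MeasurableSpace X]
    [OpensMeasurableSpace X] (A : Set X) : Prop :=
  Annihilator A ∈ residual (ProbabilityMeasure X)

open Filter in
/-- Evaluation at a closed set is upper semicontinuous for the topology of weak convergence. -/
theorem upperSemicontinuous_probabilityMeasure_apply_of_isClosed {X : Type*} [TopologicalSpace X]
    [MeasurableSpace X] [OpensMeasurableSpace X] [HasOuterApproxClosed X]
    {F : Set X} (hF : IsClosed F) :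
    UpperSemicontinuous fun μ : ProbabilityMeasure X => μ.toMeasure F :=
  upperSemicontinuous_iff_limsup_le.2 fun _ =>
    ProbabilityMeasure.limsup_measure_closed_le_of_tendsto (μs := id) tendsto_id hF

/-- The annihilator of a closed set is a Gδ set. -/
theorem isGδ_annihilator_of_isClosed {X : Type*} [TopologicalSpace X]
    [MeasurableSpace X] [OpensMeasurableSpace X] [HasOuterApproxClosed X]
    {F : Set X} (hF : IsClosed F) : IsGδ (Annihilator F) := by
  have h : Annihilator F =
      ⋂ n : ℕ, {μ : ProbabilityMeasure X | μ.toMeasure F < (n : ℝ≥0∞)⁻¹} := by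
    ext μ
    simp only [Annihilator, mem_iInter, mem_ofPred_eq]
    refine ⟨fun h n => by simp [h], fun h => ?_⟩
    by_contra h0
    obtain ⟨n, hn⟩ := ENNReal.exists_inv_nat_lt h0
    exact (hn.trans (h n)).false
  rw [h]
  exact .iInter_of_isOpen fun n =>
    (upperSemicontinuous_probabilityMeasure_apply_of_isClosed hF).isOpen_preimage _

open Filter in
/-- Pushforwards along a sequence of measurable maps converging pointwise to the identity
converge weakly to the original measure. -/
theorem tendsto_probabilityMeasure_map_of_tendsto_id {X : Type*} [TopologicalSpace X]
    [MeasurableSpace X] [OpensMeasurableSpace X]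
    (μ : ProbabilityMeasure X) {T : ℕ → X → X} (hT : ∀ n, Measurable (T n))
    (hlim : ∀ x, Tendsto (fun n => T n x) atTop (𝓝 x)) :
    Tendsto (fun n => μ.map (hT n).aemeasurable) atTop (𝓝 μ) := by
  rw [ProbabilityMeasure.tendsto_iff_forall_integral_tendsto]
  intro f
  have hmap (n : ℕ) : ∫ x, f x ∂(μ.map (hT n).aemeasurable : Measure X) =
      ∫ x, f (T n x) ∂(μ : Measure X) :=
    integral_map (hT n).aemeasurable f.continuous.measurable.aestronglyMeasurable
  simp_rw [hmap]
  refine tendsto_integral_of_dominated_convergence (fun _ => ‖f‖)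
    (fun n => (f.continuous.measurable.comp (hT n)).aestronglyMeasurable)
    (integrable_const _) (fun n => .of_forall fun x => f.norm_coe_le_norm _)
    (.of_forall fun x => (f.continuous.tendsto x).comp (hlim x))

open TopologicalSpace in
/-- In a separable metrizable space, the probability measures concentrated on a
given dense set are dense. -/
theorem dense_annihilator_compl {X : Type*} [TopologicalSpace X] [MetrizableSpace X]
    [SecondCountableTopology X] [MeasurableSpace X] [BorelSpace X]
    {U : Set X} (hU : Dense U) : Dense (Annihilator Uᶜ) := by
  let _ := metrizableSpaceMetric X
  intro μ
  have : Nonempty X := μ.nonempty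
  obtain ⟨y₀, h₀⟩ := hU.nonempty
  let T := SimpleFunc.approxOn (id : X → X) measurable_id U y₀ h₀
  refine mem_closure_of_tendsto (tendsto_probabilityMeasure_map_of_tendsto_id μ
    (fun n => (T n).measurable)
    fun x => SimpleFunc.tendsto_approxOn measurable_id h₀ (hU x)) (.of_forall fun n => ?_)
  have hmem : ∀ᵐ y ∂(μ : Measure X).map (T n), y ∈ range (T n) :=
    (ae_map_iff (T n).measurable.aemeasurable (T n).finite_range.measurableSet).2
      (.of_forall fun x => mem_range_self x)
  refine measure_mono_null (compl_subset_compl.2 ?_) (mem_ae_iff.1 hmem)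
  rintro _ ⟨x, rfl⟩
  exact SimpleFunc.approxOn_mem measurable_id h₀ n x

/-- If `A ⊆ X` is meager in a Polish space `X`, then `A` is residually null. -/
theorem meager_residuallyNull {X : Type*} [TopologicalSpace X] [PolishSpace X]
    [MeasurableSpace X] [BorelSpace X] (A : Set X) (hA : IsMeagre A) :
    ResiduallyNull A := by
  obtain ⟨S, hopen, hdense, hcount, hsub⟩ := mem_residual_iff.1 hA
  have hres : ⋂ U ∈ S, Annihilator Uᶜ ∈ residual (ProbabilityMeasure X) :=
    (countable_bInter_mem hcount).2 fun U hU => residual_of_dense_Gδ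
      (isGδ_annihilator_of_isClosed (hopen U hU).isClosed_compl)
      (dense_annihilator_compl (hdense U hU))
  refine Filter.mem_of_superset hres fun μ hμ => ?_
  refine measure_mono_null (t := ⋃ U ∈ S, Uᶜ) ?_
    ((measure_biUnion_null_iff hcount).2 fun U hU => mem_iInter₂.1 hμ U hU)
  rwa [← compl_iInter₂, ← sInter_eq_biInter, subset_compl_comm]
end

section
/- Let X be a Polish space and let A ⊆ X be a residually null set which has the Baire property. Then A is meager. -/
open MeasureTheory Set Topology
open scoped ENNReal symmDiff

/-- A set has the Baire property if its symmetric difference with some open set is meager. -/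
def HasBaireProperty {Y : Type*} [TopologicalSpace Y] (S : Set Y) : Prop :=
  ∃ U : Set Y, IsOpen U ∧ IsMeagre (S ∆ U)

open Filter

section OpenSets

variable {X : Type*} [TopologicalSpace X] [MeasurableSpace X] [OpensMeasurableSpace X]
  [HasOuterApproxClosed X]

theorem isOpen_setOf_lt_measure {U : Set X} (hU : IsOpen U) (c : ℝ≥0∞) :
    IsOpen {μ : ProbabilityMeasure X | c < μ.toMeasure U} := by
  refine isOpen_iff_mem_nhds.2 fun μ hμ ↦ ?_
  exact eventually_lt_of_lt_liminf
    (lt_of_lt_of_le hμ (ProbabilityMeasure.le_liminf_measure_open_of_tendsto tendsto_id hU))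

theorem isGδ_annihilator_compl_of_isOpen {U : Set X} (hU : IsOpen U) :
    IsGδ (Annihilator Uᶜ) := by
  have : Annihilator Uᶜ =
      ⋂ n : ℕ, {μ : ProbabilityMeasure X | 1 - (n + 1 : ℝ≥0∞)⁻¹ < μ.toMeasure U} := by
    ext μ
    simp only [Annihilator, mem_ofPred_eq, mem_iInter, prob_compl_eq_zero_iff hU.measurableSet]
    refine ⟨fun h n ↦ ?_, fun h ↦ le_antisymm prob_le_one ?_⟩
    · rw [h]
      exact ENNReal.sub_lt_self (by simp) (by simp) (by simp)
    · have ht : Tendsto (fun n : ℕ ↦ 1 - ((n + 1 : ℕ) : ℝ≥0∞)⁻¹) atTop (𝓝 (1 - 0)) :=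
        ENNReal.Tendsto.sub tendsto_const_nhds
          (ENNReal.tendsto_inv_nat_nhds_zero.comp (tendsto_add_atTop_nat 1)) (by simp)
      rw [tsub_zero] at ht
      exact le_of_tendsto' ht fun n ↦ by simpa using (h n).le
  rw [this]
  exact IsGδ.iInter_of_isOpen fun n ↦ isOpen_setOf_lt_measure hU _

theorem IsGδ.annihilator_compl {G : Set X} (hG : IsGδ G) : IsGδ (Annihilator Gᶜ) := by
  obtain ⟨U, hU, rfl⟩ := hG.eq_iInter_nat
  have : Annihilator (⋂ n, U n)ᶜ = ⋂ n, Annihilator (U n)ᶜ := by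
    ext μ
    simp [Annihilator, compl_iInter]
  rw [this]
  exact IsGδ.iInter fun n ↦ isGδ_annihilator_compl_of_isOpen (hU n)

end OpenSets

section Meagre

variable {X : Type*} [TopologicalSpace X] [TopologicalSpace.PseudoMetrizableSpace X]
  [SecondCountableTopology X] [MeasurableSpace X] [BorelSpace X]

theorem Dense.dense_annihilator_compl {U : Set X} (hU : Dense U) (hm : MeasurableSet U) :
    Dense (Annihilator Uᶜ) := by
  let _ := TopologicalSpace.pseudoMetrizableSpacePseudoMetric X
  intro μ
  obtain ⟨y, hy⟩ : U.Nonempty := by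
    have := μ.nonempty
    exact hU.nonempty
  let T := SimpleFunc.approxOn id measurable_id U y hy
  have hT (n : ℕ) : AEMeasurable (T n) μ.toMeasure := (T n).measurable.aemeasurable
  refine mem_closure_of_tendsto (f := fun n ↦ μ.map (hT n)) (b := atTop) ?_ (.of_forall fun n ↦ ?_)
  · refine ProbabilityMeasure.tendsto_iff_forall_integral_tendsto.2 fun f ↦ ?_
    have hmap (n : ℕ) : ∫ x, f x ∂(μ.map (hT n)).toMeasure = ∫ x, f (T n x) ∂μ.toMeasure := by
      rw [ProbabilityMeasure.toMeasure_map]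
      exact integral_map (hT n) f.continuous.measurable.aestronglyMeasurable
    simp_rw [hmap]
    refine tendsto_integral_of_dominated_convergence (fun _ ↦ ‖f‖)
      (fun n ↦ (f.continuous.measurable.comp (T n).measurable).aestronglyMeasurable)
      (integrable_const _) (fun n ↦ .of_forall fun x ↦ f.norm_coe_le_norm _)
      (.of_forall fun x ↦ ?_)
    exact (f.continuous.tendsto x).comp (SimpleFunc.tendsto_approxOn measurable_id hy (hU x))
  · have : T n ⁻¹' Uᶜ = ∅ :=
      eq_empty_of_forall_notMem fun x hx ↦ hx (SimpleFunc.approxOn_mem measurable_id hy n x)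
    simp [Annihilator, ProbabilityMeasure.toMeasure_map,
      Measure.map_apply (T n).measurable hm.compl, this]

theorem IsMeagre.residuallyNull {M : Set X} (hM : IsMeagre M) : ResiduallyNull M := by
  obtain ⟨S, hS, hdense, hc, hsub⟩ := mem_residual_iff.1 hM
  have : ⋂ U ∈ S, Annihilator Uᶜ ∈ residual (ProbabilityMeasure X) :=
    (countable_bInter_mem hc).2 fun U hU ↦ residual_of_dense_Gδ
      (isGδ_annihilator_compl_of_isOpen (hS U hU))
      ((hdense U hU).dense_annihilator_compl (hS U hU).measurableSet)
  refine mem_of_superset this fun μ hμ ↦ ?_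
  have h0 : μ.toMeasure (⋃ U ∈ S, Uᶜ) = 0 :=
    (measure_biUnion_null_iff hc).2 fun U hU ↦ mem_iInter₂.1 hμ U hU
  refine measure_mono_null (fun x hx ↦ ?_) h0
  by_contra h
  refine hsub (fun U hU ↦ ?_) hx
  by_contra hxU
  exact h (mem_biUnion hU hxU)

end Meagre

section Baire

theorem Topology.IsEmbedding.isGδ_range {X Y : Type*} [TopologicalSpace X]
    [TopologicalSpace.IsCompletelyMetrizableSpace X] [TopologicalSpace Y]
    [TopologicalSpace.MetrizableSpace Y] {f : X → Y} (hf : IsEmbedding f) :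
    IsGδ (range f) := by
  let _ := TopologicalSpace.upgradeIsCompletelyMetrizable X
  let _ := TopologicalSpace.metrizableSpaceMetric Y
  let W (n : ℕ) : Set Y :=
    ⋃₀ {V | IsOpen V ∧ ∀ a ∈ f ⁻¹' V, ∀ b ∈ f ⁻¹' V, dist a b < 1 / (n + 1 : ℝ)}
  have hW (n : ℕ) : IsOpen (W n) := isOpen_sUnion fun V hV ↦ hV.1
  have : range f = closure (range f) ∩ ⋂ n, W n := by
    refine Subset.antisymm ?_ ?_
    · rintro _ ⟨x, rfl⟩
      refine ⟨subset_closure (mem_range_self x), mem_iInter.2 fun n ↦ ?_⟩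
      have hn : (0 : ℝ) < 1 / (n + 1 : ℝ) / 2 := by positivity
      obtain ⟨V, hV, hVx⟩ := hf.isInducing.isOpen_iff.1
        (Metric.isOpen_ball (x := x) (ε := 1 / (n + 1 : ℝ) / 2))
      refine ⟨V, ⟨hV, fun a ha b hb ↦ ?_⟩, ?_⟩
      · rw [hVx, Metric.mem_ball] at ha hb
        linarith [dist_triangle_right a b x]
      · change x ∈ f ⁻¹' V
        rw [hVx]
        exact Metric.mem_ball_self hn
    · rintro z ⟨hz, hzW⟩
      have hne : (comap f (𝓝 z)).NeBot := comap_neBot fun t ht ↦ by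
        obtain ⟨_, hy, x, rfl⟩ := mem_closure_iff_nhds.1 hz t ht
        exact ⟨x, hy⟩
      have hcauchy : Cauchy (comap f (𝓝 z)) := by
        refine Metric.cauchy_iff.2 ⟨hne, fun ε hε ↦ ?_⟩
        obtain ⟨n, hn⟩ := exists_nat_one_div_lt hε
        obtain ⟨V, ⟨hV, hVd⟩, hzV⟩ := mem_iInter.1 hzW n
        exact ⟨f ⁻¹' V, preimage_mem_comap (hV.mem_nhds hzV),
          fun a ha b hb ↦ (hVd a ha b hb).trans hn⟩
      obtain ⟨x, hx⟩ := CompleteSpace.complete hcauchy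
      exact ⟨x, tendsto_nhds_unique ((hf.continuous.tendsto x).mono_left hx) tendsto_comap⟩
  rw [this]
  exact isClosed_closure.isGδ.inter (IsGδ.iInter_of_isOpen hW)

theorem Topology.IsEmbedding.isEmbedding_probabilityMeasure_map {X Y : Type*}
    [TopologicalSpace X] [TopologicalSpace.PseudoMetrizableSpace X] [SecondCountableTopology X]
    [MeasurableSpace X] [BorelSpace X]
    [TopologicalSpace Y] [TopologicalSpace.PseudoMetrizableSpace Y] [SecondCountableTopology Y]
    [MeasurableSpace Y] [BorelSpace Y] {f : X → Y} (hf : IsEmbedding f) :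
    IsEmbedding fun μ : ProbabilityMeasure X ↦
      μ.map (hf.continuous.measurable.aemeasurable (μ := μ.toMeasure)) := by
  have hmap (μ : ProbabilityMeasure X) {V : Set Y} (hV : IsOpen V) :
      (μ.map (hf.continuous.measurable.aemeasurable (μ := μ.toMeasure))).toMeasure V =
        μ.toMeasure (f ⁻¹' V) := by
    rw [ProbabilityMeasure.toMeasure_map]
    exact Measure.map_apply hf.continuous.measurable hV.measurableSet
  refine IsInducing.isEmbedding (isInducing_iff_nhds.2 fun μ ↦ le_antisymm ?_ ?_)
  · exact ((ProbabilityMeasure.continuous_map hf.continuous).tendsto μ).le_comap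
  · refine tendsto_of_forall_isOpen_le_liminf' (μs := id) (μ := μ)
      (L := comap _ (𝓝 (μ.map hf.continuous.measurable.aemeasurable))) fun G hG ↦ ?_
    obtain ⟨V, hV, rfl⟩ := hf.isInducing.isOpen_iff.1 hG
    have := ProbabilityMeasure.le_liminf_measure_open_of_tendsto
      (tendsto_comap (f := fun μ : ProbabilityMeasure X ↦
        μ.map (hf.continuous.measurable.aemeasurable (μ := μ.toMeasure)))) hV
      (μ := μ.map hf.continuous.measurable.aemeasurable)
    simpa only [hmap _ hV, id] using this

theorem baireSpace_probabilityMeasure (X : Type*) [TopologicalSpace X] [PolishSpace X]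
    [MeasurableSpace X] [BorelSpace X] : BaireSpace (ProbabilityMeasure X) := by
  let _ := TopologicalSpace.upgradeIsCompletelyMetrizable X
  obtain ⟨f, hf⟩ := Metric.PiNatEmbed.exists_embedding_to_hilbert_cube (X := X)
  have hG : IsGδ (range f) := hf.isGδ_range
  have hemb := hf.isEmbedding_probabilityMeasure_map
  have hme : MeasurableEmbedding f := hf.measurableEmbedding hG.measurableSet
  have hrange : range (fun μ : ProbabilityMeasure X ↦
      μ.map (hf.continuous.measurable.aemeasurable (μ := μ.toMeasure))) =
        Annihilator (range f)ᶜ := by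
    ext ν
    constructor
    · rintro ⟨μ, rfl⟩
      simp [Annihilator, ProbabilityMeasure.toMeasure_map,
        Measure.map_apply hf.continuous.measurable hG.measurableSet.compl]
    · intro hν
      have hmc : (ν.toMeasure.comap f).map f = ν.toMeasure := by
        rw [hme.map_comap]
        exact Measure.restrict_eq_self_of_ae_mem (mem_ae_iff.2 hν)
      have hp : IsProbabilityMeasure (ν.toMeasure.comap f) := by
        have : IsProbabilityMeasure ((ν.toMeasure.comap f).map f) := by
          rw [hmc]; infer_instance
        exact Measure.isProbabilityMeasure_of_map f
      exact ⟨⟨ν.toMeasure.comap f, hp⟩, ProbabilityMeasure.toMeasure_injective hmc⟩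
  have : BaireSpace (range (fun μ : ProbabilityMeasure X ↦
      μ.map (hf.continuous.measurable.aemeasurable (μ := μ.toMeasure)))) := by
    rw [hrange]
    exact hG.annihilator_compl.baireSpace_of_t2Space_locallyCompactSpace
  exact hemb.toHomeomorph.symm.baireSpace

end Baire

/-- A residually null set with the Baire property is meager. -/
theorem residuallyNull_baireProperty_meager {X : Type*} [TopologicalSpace X] [PolishSpace X]
    [MeasurableSpace X] [BorelSpace X] (A : Set X)
    (h1 : ResiduallyNull A) (h2 : HasBaireProperty A) :
    IsMeagre A := by
  obtain ⟨U, hU, hM⟩ := h2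
  have := baireSpace_probabilityMeasure X
  rcases U.eq_empty_or_nonempty with rfl | ⟨x, hx⟩
  · rwa [← bot_eq_empty, symmDiff_bot] at hM
  have hdense := dense_of_mem_residual (inter_mem h1 hM.residuallyNull)
  obtain ⟨μ, hμU, hμA, hμM⟩ := hdense.inter_open_nonempty _ (isOpen_setOf_lt_measure hU 0)
    ⟨diracProba x, by simp [hx]⟩
  refine absurd (measure_mono_null (fun y hy ↦ ?_) (measure_union_null hμA hμM)) hμU.ne'
  by_cases hyA : y ∈ A
  · exact Or.inl hyA
  · exact Or.inr (Or.inr ⟨hy, hyA⟩)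
end

section
/- Let X be a Polish space and A ⊆ X. Then A is a Borel subset of X if and only if its annihilator 𝓝(A) is a Borel subset of 𝓜(X). -/
open MeasureTheory Set Topology
open scoped ENNReal symmDiff

/-- For a measurable set `A`, the map `μ ↦ μ A` is Borel measurable for the topology of weak
convergence of probability measures. -/
theorem measurable_borel_probabilityMeasure_apply {X : Type*} [TopologicalSpace X]
    [HasOuterApproxClosed X] [MeasurableSpace X] [BorelSpace X] {A : Set X}
    (hA : MeasurableSet A) :
    Measurable[borel (ProbabilityMeasure X)]
      (fun μ : ProbabilityMeasure X ↦ μ.toMeasure A) := by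
  let _ : MeasurableSpace (ProbabilityMeasure X) := borel _
  have : BorelSpace (ProbabilityMeasure X) := ⟨rfl⟩
  have h : Measurable (fun μ : ProbabilityMeasure X ↦ μ.toMeasure) := by
    refine Measurable.measure_of_isPiSystem_of_isProbabilityMeasure
      (S := {s : Set X | IsOpen s}) (BorelSpace.measurable_eq (α := X)) isPiSystem_isOpen
      fun G hG ↦ LowerSemicontinuous.measurable ?_
    refine lowerSemicontinuous_iff_le_liminf.2 fun μ ↦ ?_
    exact ProbabilityMeasure.le_liminf_measure_open_of_tendsto Filter.tendsto_id hG
  exact (Measure.measurable_coe hA).comp h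

theorem preimage_diracProba_annihilator {X : Type*} [MeasurableSpace X]
    [MeasurableSingletonClass X] (A : Set X) : diracProba ⁻¹' Annihilator A = Aᶜ := by
  ext x
  simp [Annihilator]

/-- `A ⊆ X` is Borel iff its annihilator is a Borel subset of `𝓜(X)`. -/
theorem measurableSet_iff_measurableSet_annihilator {X : Type*} [TopologicalSpace X]
    [PolishSpace X] [MeasurableSpace X] [BorelSpace X] (A : Set X) :
    MeasurableSet A ↔ MeasurableSet[borel (ProbabilityMeasure X)] (Annihilator A) := by
  let _ : MeasurableSpace (ProbabilityMeasure X) := borel _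
  have : BorelSpace (ProbabilityMeasure X) := ⟨rfl⟩
  refine ⟨fun hA ↦ measurable_borel_probabilityMeasure_apply hA (measurableSet_singleton 0),
    fun h ↦ ?_⟩
  have hc := continuous_diracProba.measurable h
  rw [preimage_diracProba_annihilator] at hc
  exact hc.of_compl
end

section
/- Let X be a Polish space. The collection EBP(X) of all EBP-sets is a σ-algebra on X, and it is the smallest σ-algebra containing all open subsets of X and all residually null subsets of X. -/
open MeasureTheory Set Topology
open scoped ENNReal symmDiff

/-- `A` is an EBP-set (extended Baire property) if its symmetric difference with some
open set is residually null. -/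
def EBPSet {X : Type*} [TopologicalSpace X] [MeasurableSpace X]
    [OpensMeasurableSpace X] (A : Set X) : Prop :=
  ∃ U : Set X, IsOpen U ∧ ResiduallyNull (A ∆ U)

open Filter

theorem Annihilator.anti {X : Type*} [MeasurableSpace X] {A B : Set X} (h : A ⊆ B) :
    Annihilator B ⊆ Annihilator A :=
  fun _ hμ => measure_mono_null h hμ

section WeakConvergence

variable {X : Type*} [TopologicalSpace X] [MeasurableSpace X]

theorem ResiduallyNull.mono [OpensMeasurableSpace X] {A B : Set X} (hB : ResiduallyNull B)
    (h : A ⊆ B) : ResiduallyNull A :=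
  mem_of_superset hB (Annihilator.anti h)

theorem ResiduallyNull.empty [OpensMeasurableSpace X] : ResiduallyNull (∅ : Set X) :=
  univ_mem' fun _ => measure_empty

theorem ResiduallyNull.iUnion [OpensMeasurableSpace X] {ι : Type*} [Countable ι] {A : ι → Set X}
    (h : ∀ i, ResiduallyNull (A i)) : ResiduallyNull (⋃ i, A i) := by
  filter_upwards [countable_iInter_mem.2 h] with μ hμ
  exact measure_iUnion_null fun i => mem_iInter.1 hμ i

theorem ResiduallyNull.union [OpensMeasurableSpace X] {A B : Set X} (hA : ResiduallyNull A)
    (hB : ResiduallyNull B) : ResiduallyNull (A ∪ B) := by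
  filter_upwards [hA, hB] with μ hμA hμB
  exact measure_union_null hμA hμB

/-- Evaluation on a closed set is upper semicontinuous for weak convergence. -/
theorem IsClosed.isOpen_setOf_probabilityMeasure_lt [OpensMeasurableSpace X]
    [HasOuterApproxClosed X] {F : Set X} (hF : IsClosed F) (c : ℝ≥0∞) :
    IsOpen {μ : ProbabilityMeasure X | μ.toMeasure F < c} := by
  refine isOpen_iff_mem_nhds.2 fun μ hμ => ?_
  have h := ProbabilityMeasure.limsup_measure_closed_le_of_tendsto
    (tendsto_id : Tendsto id (𝓝 μ) (𝓝 μ)) hF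
  exact eventually_lt_of_limsup_lt (h.trans_lt hμ)

/-- Weak limits of measures concentrated on a dense Borel set exhaust all measures. -/
theorem dense_annihilator_compl_s8 [PolishSpace X] [BorelSpace X] {s : Set X}
    (hs : MeasurableSet s) (hd : Dense s) : Dense (Annihilator sᶜ) := by
  let := TopologicalSpace.upgradeIsCompletelyMetrizable X
  intro μ
  have := μ.nonempty
  obtain ⟨y, hy⟩ := hd.nonempty
  let T := SimpleFunc.approxOn (id : X → X) measurable_id s y hy
  refine mem_closure_of_tendsto (b := atTop)
    (f := fun n => μ.map (T n).measurable.aemeasurable) ?_ (Eventually.of_forall fun n => ?_)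
  · refine ProbabilityMeasure.tendsto_iff_forall_integral_tendsto.2 fun f => ?_
    have hmap (n : ℕ) : ∫ x, f x ∂(μ.map (T n).measurable.aemeasurable).toMeasure =
        ∫ x, f (T n x) ∂μ.toMeasure := by
      rw [ProbabilityMeasure.toMeasure_map]
      exact integral_map (T n).measurable.aemeasurable
        f.continuous.stronglyMeasurable.aestronglyMeasurable
    simp_rw [hmap]
    refine tendsto_integral_of_dominated_convergence (fun _ => ‖f‖)
      (fun n => (f.continuous.measurable.comp (T n).measurable).aestronglyMeasurable)
      (integrable_const _) (fun n => ae_of_all _ fun x => f.norm_coe_le_norm _)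
      (ae_of_all _ fun x => ?_)
    exact (f.continuous.tendsto x).comp
      (SimpleFunc.tendsto_approxOn measurable_id hy (hd x))
  · change (μ.map (T n).measurable.aemeasurable).toMeasure sᶜ = 0
    rw [ProbabilityMeasure.toMeasure_map, Measure.map_apply (T n).measurable hs.compl]
    convert measure_empty (μ := μ.toMeasure)
    exact eq_empty_of_forall_notMem fun x hx =>
      hx (SimpleFunc.approxOn_mem measurable_id hy n x)

theorem IsClosed.residuallyNull [PolishSpace X] [BorelSpace X] {F : Set X} (hF : IsClosed F)
    (hF' : interior F = ∅) : ResiduallyNull F := by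
  let := TopologicalSpace.upgradeIsCompletelyMetrizable X
  have hd : Dense (Annihilator F) := by
    simpa using dense_annihilator_compl_s8 hF.measurableSet.compl
      (interior_eq_empty_iff_dense_compl.1 hF')
  have h (n : ℕ) : {μ : ProbabilityMeasure X | μ.toMeasure F < (n : ℝ≥0∞)⁻¹} ∈ residual _ := by
    refine residual_of_dense_open (hF.isOpen_setOf_probabilityMeasure_lt _)
      (hd.mono fun μ hμ => ?_)
    change μ.toMeasure F < _
    rw [show μ.toMeasure F = 0 from hμ]
    exact ENNReal.inv_pos.2 (ENNReal.natCast_ne_top n)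
  filter_upwards [countable_iInter_mem.2 h] with μ hμ
  by_contra hne
  obtain ⟨n, hn⟩ := ENNReal.exists_inv_nat_lt hne
  exact lt_asymm hn (mem_iInter.1 hμ n)

theorem EBPSet.compl [PolishSpace X] [BorelSpace X] {A : Set X} (hA : EBPSet A) :
    EBPSet Aᶜ := by
  obtain ⟨U, hU, h⟩ := hA
  refine ⟨(closure U)ᶜ, isClosed_closure.isOpen_compl,
    (h.union ((isClosed_frontier (s := U)).residuallyNull ?_)).mono ?_⟩
  · simpa using interior_frontier hU.isClosed_compl
  intro x
  have := @subset_closure _ _ U x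
  simp only [mem_symmDiff, hU.frontier_eq, mem_union, Set.mem_sdiff, mem_compl_iff]
  tauto

theorem EBPSet.iUnion [OpensMeasurableSpace X] {ι : Type*} [Countable ι] {A : ι → Set X}
    (hA : ∀ i, EBPSet (A i)) : EBPSet (⋃ i, A i) := by
  choose U hU h using hA
  refine ⟨⋃ i, U i, isOpen_iUnion hU, (ResiduallyNull.iUnion h).mono ?_⟩
  rintro x (⟨hx, hx'⟩ | ⟨hx, hx'⟩) <;> obtain ⟨i, hi⟩ := mem_iUnion.1 hx
  · exact mem_iUnion.2 ⟨i, .inl ⟨hi, fun h => hx' (mem_iUnion.2 ⟨i, h⟩)⟩⟩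
  · exact mem_iUnion.2 ⟨i, .inr ⟨hi, fun h => hx' (mem_iUnion.2 ⟨i, h⟩)⟩⟩

theorem IsOpen.ebpSet [OpensMeasurableSpace X] {U : Set X} (hU : IsOpen U) : EBPSet U :=
  ⟨U, hU, by simpa using ResiduallyNull.empty⟩

theorem ResiduallyNull.ebpSet [OpensMeasurableSpace X] {A : Set X} (hA : ResiduallyNull A) :
    EBPSet A :=
  ⟨∅, isOpen_empty, hA.mono (by simp [symmDiff_def])⟩

end WeakConvergence

/-- The collection of EBP-sets coincides with the σ-algebra generated by the open sets
together with the residually null sets; in particular `EBP(X)` is a σ-algebra and is the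
smallest σ-algebra containing the open sets and the residually null sets. -/
theorem ebp_eq_generated_sigmaAlgebra {X : Type*} [TopologicalSpace X] [PolishSpace X]
    [MeasurableSpace X] [BorelSpace X] (A : Set X) :
    MeasurableSet[MeasurableSpace.generateFrom
        {S : Set X | IsOpen S ∨ ResiduallyNull S}] A ↔ EBPSet A := by
  constructor
  · intro hA
    induction A, hA using MeasurableSpace.generateFrom_induction with
    | hC S hS => exact hS.elim IsOpen.ebpSet ResiduallyNull.ebpSet
    | empty => exact isOpen_empty.ebpSet
    | compl S _ hS => exact hS.compl
    | iUnion S _ hS => exact EBPSet.iUnion hS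
  · rintro ⟨U, hU, h⟩
    rw [← symmDiff_symmDiff_cancel_right U A]
    exact (MeasurableSpace.measurableSet_generateFrom (.inr h)).symmDiff
      (MeasurableSpace.measurableSet_generateFrom (.inl hU))
end

section
/- Let X be a Polish space. Every EBP-set A ⊆ X is residually measurable, i.e., the set of μ ∈ 𝓜(X) for which A is μ-measurable is comeager in 𝓜(X). -/
open MeasureTheory Set Topology
open scoped ENNReal symmDiff

/-- Every EBP-set is residually measurable. -/
theorem ebp_residuallyMeasurable {X : Type*} [TopologicalSpace X] [PolishSpace X]
    [MeasurableSpace X] [BorelSpace X] (A : Set X) (h : EBPSet A) :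
    {μ : ProbabilityMeasure X | NullMeasurableSet A μ.toMeasure} ∈
      residual (ProbabilityMeasure X) := by
  obtain ⟨U, hU, hAU⟩ := h
  refine Filter.mem_of_superset hAU fun μ hμ ↦ ?_
  exact hU.measurableSet.nullMeasurableSet.congr (measure_symmDiff_eq_zero_iff.mp hμ).symm
end

section
/- Let X be a Polish space, Y a topological space with a countable basis, and f : X → Y an EBP-measurable function. Then there exists a set A ⊆ X whose complement is residually null such that the restriction of f to A is continuous (with A carrying the subspace topology). -/
open MeasureTheory Set Topology
open scoped ENNReal symmDiff

theorem residuallyNull_biUnion {X ι : Type*} [TopologicalSpace X] [MeasurableSpace X]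
    [OpensMeasurableSpace X] {I : Set ι} (hI : I.Countable) {A : ι → Set X}
    (hA : ∀ i ∈ I, ResiduallyNull (A i)) : ResiduallyNull (⋃ i ∈ I, A i) := by
  refine Filter.mem_of_superset ((countable_bInter_mem hI).2 hA) fun μ hμ => ?_
  exact (measure_biUnion_null_iff hI).2 fun i hi => mem_iInter₂.1 hμ i hi

/-- If `Y` has a countable basis and `f : X → Y` is EBP-measurable, then there is a
co-residually null set `A` such that the restriction of `f` to `A` is continuous. -/
theorem ebp_measurable_continuous_on_coResiduallyNull {X : Type*} [TopologicalSpace X]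
    [PolishSpace X] [MeasurableSpace X] [BorelSpace X]
    {Y : Type*} [TopologicalSpace Y] [SecondCountableTopology Y] (f : X → Y)
    (hf : ∀ V : Set Y, IsOpen V → EBPSet (f ⁻¹' V)) :
    ∃ A : Set X, ResiduallyNull Aᶜ ∧ Continuous (A.restrict f) := by
  choose! U hU hnull using hf
  have hB := TopologicalSpace.isBasis_countableBasis Y
  refine ⟨(⋃ V ∈ TopologicalSpace.countableBasis Y, (f ⁻¹' V) ∆ U V)ᶜ, ?_, ?_⟩
  · rw [compl_compl]
    exact residuallyNull_biUnion (TopologicalSpace.countable_countableBasis Y)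
      fun V hV => hnull V (hB.isOpen hV)
  · refine hB.continuous_iff.2 fun V hV => ?_
    refine ⟨U V, hU V (hB.isOpen hV), ?_⟩
    ext ⟨x, hx⟩
    have hxV : x ∉ (f ⁻¹' V) ∆ U V := fun h => hx (mem_biUnion hV h)
    rw [mem_symmDiff] at hxV
    simp only [mem_preimage] at hxV ⊢
    tauto
end
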